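/- Let p be a prime, K a field of characteristic p, and d, h natural numbers with h ≥ 1, d = h·p and p not dividing h. Let σ be a permutation of {1,…,d} whose cycle type consists of exactly h cycles of length p (so σ has no fixed points), and let g denote the induced action of σ on the fully deleted permutation module V for S_d over K. Then for every natural number k, the dimension over K of the kernel of (g − id)^k equals (h−1)·min(k,p) + min(k,p−2); equivalently, g has Jordan form [J_p^{h−1}, J_{p−2}] on V. -/

import Mathlib

/-- The sum-of-coordinates functional on `K^d`. -/
def sumFunctional (K : Type*) [Field K] (d : ℕ) : (Fin d → K) →ₗ[K] K where
  toFun v := ∑ i, v i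
  map_add' u v := by simp [Finset.sum_add_distrib]
  map_smul' c v := by simp [Finset.mul_sum]

/-- The zero-sum submodule `U` of the permutation module `K^d`. -/
def zeroSum (K : Type*) [Field K] (d : ℕ) : Submodule K (Fin d → K) :=
  LinearMap.ker (sumFunctional K d)

/-- The submodule `W` of constant vectors in `K^d`. -/
def constSub (K : Type*) [Field K] (d : ℕ) : Submodule K (Fin d → K) :=
  Submodule.span K {(fun _ => 1 : Fin d → K)}

/-- `U ∩ W`, viewed as a submodule of `U`. -/
def UW (K : Type*) [Field K] (d : ℕ) : Submodule K (zeroSum K d) :=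
  (zeroSum K d ⊓ constSub K d).comap (zeroSum K d).subtype

/-- The fully deleted permutation module `V = U/(U ∩ W)` for `S_d` over `K`. -/
abbrev deletedPermModule (K : Type*) [Field K] (d : ℕ) :=
  zeroSum K d ⧸ UW K d

/-- The linear action of a permutation `σ` on `K^d`, `v ↦ v ∘ σ`. -/
def permMap (K : Type*) [Field K] {d : ℕ} (σ : Equiv.Perm (Fin d)) :
    (Fin d → K) →ₗ[K] (Fin d → K) :=
  LinearMap.funLeft K K σ

lemma permMap_mem_zeroSum (K : Type*) [Field K] {d : ℕ} (σ : Equiv.Perm (Fin d))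
    {v : Fin d → K} (hv : v ∈ zeroSum K d) : permMap K σ v ∈ zeroSum K d := by
  simp only [zeroSum, LinearMap.mem_ker] at hv ⊢
  simpa [permMap, sumFunctional, LinearMap.funLeft, Equiv.sum_comp σ v] using hv

lemma permMap_mem_constSub (K : Type*) [Field K] {d : ℕ} (σ : Equiv.Perm (Fin d))
    {v : Fin d → K} (hv : v ∈ constSub K d) : permMap K σ v ∈ constSub K d := by
  rw [constSub, Submodule.mem_span_singleton] at hv ⊢
  obtain ⟨c, rfl⟩ := hv
  exact ⟨c, rfl⟩

/-- The endomorphism of the fully deleted permutation module induced by a permutation. -/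
def permEnd (K : Type*) [Field K] {d : ℕ} (σ : Equiv.Perm (Fin d)) :
    deletedPermModule K d →ₗ[K] deletedPermModule K d :=
  Submodule.mapQ (UW K d) (UW K d)
    ((permMap K σ).restrict (fun _ hv => permMap_mem_zeroSum K σ hv))
    (by
      rintro ⟨v, hvU⟩ hv
      simp only [UW, Submodule.mem_comap, Submodule.mem_inf, Submodule.coe_subtype,
        LinearMap.restrict_apply] at hv ⊢
      exact ⟨permMap_mem_zeroSum K σ hv.1, permMap_mem_constSub K σ hv.2⟩)

open Module in
lemma Submodule.finrank_comap_eq {K M M' : Type*} [Field K] [AddCommGroup M] [Module K M]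
    [AddCommGroup M'] [Module K M'] [FiniteDimensional K M] (f : M →ₗ[K] M')
    (S : Submodule K M') :
    finrank K (S.comap f) = finrank K (LinearMap.range f ⊓ S : Submodule K M') +
      finrank K (LinearMap.ker f) := by
  have hle : LinearMap.ker f ≤ S.comap f := fun x hx => by
    rw [Submodule.mem_comap, LinearMap.mem_ker.1 hx]; exact S.zero_mem
  rw [← LinearMap.finrank_range_add_finrank_ker (f.domRestrict (S.comap f)),
    LinearMap.range_domRestrict, Submodule.map_comap_eq, LinearMap.ker_domRestrict]
  congr 1
  exact (Submodule.comapSubtypeEquivOfLe hle).finrank_eq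

section Nilpotent

open Module

variable {K M : Type*} [Field K] [AddCommGroup M] [Module K M] [FiniteDimensional K M]

lemma Module.End.finrank_ker_pow_add_le (N : End K M) {h : ℕ}
    (hker : finrank K (LinearMap.ker N) ≤ h) (k j : ℕ) :
    finrank K (LinearMap.ker (N ^ (k + j))) ≤ finrank K (LinearMap.ker (N ^ k)) + h * j := by
  induction j with
  | zero => simp
  | succ j ih =>
    have hcomap : LinearMap.ker (N ^ (k + (j + 1))) = (LinearMap.ker (N ^ (k + j))).comap N := by
      rw [← add_assoc, pow_succ]; rfl
    have hinf : finrank K (LinearMap.range N ⊓ LinearMap.ker (N ^ (k + j)) : Submodule K M) ≤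
        finrank K (LinearMap.ker (N ^ (k + j))) := Submodule.finrank_mono inf_le_right
    rw [hcomap, Submodule.finrank_comap_eq, mul_add]
    lia

lemma Module.End.finrank_ker_pow_of_pow_eq_zero (N : End K M) {h p k : ℕ} (hN : N ^ p = 0)
    (hM : finrank K M = h * p) (hker : finrank K (LinearMap.ker N) ≤ h) (hk : k ≤ p) :
    finrank K (LinearMap.ker (N ^ k)) = h * k := by
  obtain ⟨j, rfl⟩ := Nat.exists_eq_add_of_le hk
  have upper := N.finrank_ker_pow_add_le hker 0 k
  have lower := N.finrank_ker_pow_add_le hker k j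
  rw [hN, LinearMap.ker_zero, finrank_top, hM, mul_add] at lower
  rw [pow_zero, Module.End.one_eq_id, LinearMap.ker_id, finrank_bot, zero_add, zero_add] at upper
  lia

lemma Module.End.ker_pow_pred_eq_range (N : End K M) {h q : ℕ} (hN : N ^ (q + 1) = 0)
    (hM : finrank K M = h * (q + 1)) (hker : finrank K (LinearMap.ker N) ≤ h) :
    LinearMap.range N = LinearMap.ker (N ^ q) := by
  refine Submodule.eq_of_le_of_finrank_eq ?_ ?_
  · rintro _ ⟨x, rfl⟩
    rw [LinearMap.mem_ker, ← Module.End.mul_apply, ← pow_succ, hN, LinearMap.zero_apply]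
  · have hq := N.finrank_ker_pow_of_pow_eq_zero hN hM hker q.le_succ
    have h1 := N.finrank_ker_pow_of_pow_eq_zero hN hM hker (Nat.le_add_left 1 q)
    have := LinearMap.finrank_range_add_finrank_ker N
    rw [pow_one] at h1
    rw [hM, mul_add] at this
    lia

lemma finrank_ker_add_one {φ : M →ₗ[K] K} {t : M} (ht : φ t ≠ 0) :
    finrank K (LinearMap.ker φ) + 1 = finrank K M :=
  Module.Dual.finrank_ker_add_one_of_ne_zero (f := φ) fun h0 => ht (by simp [h0])

/-- The preimage of an `N`-invariant line under `N ^ k`, inside an `N`-invariant hyperplane. -/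
lemma Module.End.finrank_comap_span_inf_ker (N : End K M) (φ : M →ₗ[K] K) {h p : ℕ} {e t : M}
    (hp : 2 ≤ p) (hh : 1 ≤ h) (hN : N ^ p = 0) (hM : finrank K M = h * p)
    (hker : finrank K (LinearMap.ker N) ≤ h) (hφN : φ ∘ₗ N = 0) (he : e ≠ 0) (hNe : N e = 0)
    (hte : (N ^ (p - 1)) t = e) (ht : φ t ≠ 0) (k : ℕ) :
    finrank K ((K ∙ e).comap (N ^ k) ⊓ LinearMap.ker φ : Submodule K M) =
      (h - 1) * min k p + min k (p - 2) + 1 := by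
  obtain ⟨q, rfl⟩ := Nat.exists_eq_add_of_le' hp
  obtain ⟨h, rfl⟩ := Nat.exists_eq_add_of_le' hh
  have hφ := finrank_ker_add_one ht
  have finrank_comap {k : ℕ} (hk : k ≤ q + 1) :
      finrank K ((K ∙ e).comap (N ^ k)) = (h + 1) * k + 1 := by
    have hmem : (K ∙ e) ≤ LinearMap.range (N ^ k) := by
      rw [Submodule.span_singleton_le_iff_mem]
      refine ⟨(N ^ (q + 1 - k)) t, ?_⟩
      rw [← Module.End.mul_apply, ← pow_add, Nat.add_sub_cancel' hk]
      exact hte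
    rw [Submodule.finrank_comap_eq, inf_eq_right.2 hmem, finrank_span_singleton he,
      N.finrank_ker_pow_of_pow_eq_zero hN hM hker (by lia), add_comm]
  rcases lt_trichotomy k (q + 1) with hk | rfl | hk
  · have hle : (K ∙ e).comap (N ^ k) ≤ LinearMap.ker φ := by
      intro v hv
      obtain ⟨c, hc⟩ := Submodule.mem_span_singleton.1 hv
      have hv' : v ∈ LinearMap.range N := by
        rw [N.ker_pow_pred_eq_range (q := q + 1) hN hM hker, LinearMap.mem_ker]
        obtain ⟨j, hj⟩ := Nat.exists_eq_add_of_le' (Nat.succ_le_of_lt hk)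
        rw [hj, pow_add, pow_succ', Module.End.mul_apply, Module.End.mul_apply, ← hc, map_smul,
          hNe, smul_zero, map_zero]
      obtain ⟨w, rfl⟩ := hv'
      exact LinearMap.congr_fun hφN w
    rw [inf_eq_left.2 hle, finrank_comap hk.le, min_eq_left (by lia), min_eq_left (by lia)]
    simp only [Nat.add_sub_cancel]
    ring
  · set A := (K ∙ e).comap (N ^ (q + 1))
    have htA : t ∈ A := Submodule.mem_span_singleton.2 ⟨1, by rw [one_smul]; exact hte.symm⟩
    have hA := finrank_ker_add_one (φ := φ.domRestrict A) (t := ⟨t, htA⟩) ht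
    have hinf := Submodule.finrank_map_subtype_eq A (LinearMap.ker (φ.domRestrict A))
    rw [LinearMap.ker_domRestrict, Submodule.map_comap_subtype] at hinf
    rw [LinearMap.ker_domRestrict, finrank_comap le_rfl] at hA
    rw [hinf, min_eq_left (by lia), min_eq_right (by lia)]
    simp only [Nat.add_sub_cancel]
    linarith
  · have hzero : N ^ k = 0 := pow_eq_zero_of_le hk hN
    have htop : (K ∙ e).comap (N ^ k) = ⊤ := by
      rw [hzero, Submodule.comap_zero]
    rw [htop, top_inf_eq, min_eq_right (by lia), min_eq_right (by lia)]
    simp only [Nat.add_sub_cancel]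
    linarith

end Nilpotent

open Polynomial in
lemma sub_one_pow_pred_eq_geom_sum {R : Type*} (p : ℕ) [Fact p.Prime] [Ring R] [CharP R p]
    (x : R) : (x - 1) ^ (p - 1) = ∑ i ∈ Finset.range p, x ^ i := by
  have key := cyclotomic_mul_prime_eq_pow_of_not_dvd (ZMod p) (p := p) (n := 1)
    (Nat.Prime.not_dvd_one Fact.out)
  rw [one_mul, cyclotomic_prime, cyclotomic_one] at key
  let : Algebra (ZMod p) R := ZMod.algebra _ _
  simpa using (congrArg (aeval x) key).symm

section Orbits

open Equiv.Perm

variable {d h p : ℕ} {σ : Equiv.Perm (Fin d)}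

lemma pow_eq_one_of_cycleType_eq_replicate
    (hσ : σ.cycleType = Multiset.replicate h p) : σ ^ p = 1 := by
  rw [← orderOf_dvd_iff_pow_eq_one, ← lcm_cycleType, hσ, Multiset.lcm_dvd]
  intro b hb
  rw [Multiset.eq_of_mem_replicate hb]

lemma minimalPeriod_of_cycleType_eq_replicate (hp : p.Prime) (hd : d = h * p)
    (hσ : σ.cycleType = Multiset.replicate h p) (x : Fin d) :
    Function.minimalPeriod σ x = p := by
  have := Fact.mk hp
  have hsupp : σ.support = Finset.univ := by
    rw [← Finset.card_eq_iff_eq_univ, ← sum_cycleType, hσ, Multiset.sum_replicate,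
      Fintype.card_fin, hd, smul_eq_mul]
  refine Function.minimalPeriod_eq_prime ?_ ?_
  · rw [Function.IsPeriodicPt, Function.IsFixedPt, iterate_eq_pow,
      pow_eq_one_of_cycleType_eq_replicate hσ, one_apply]
  · exact mem_support.1 (hsupp ▸ Finset.mem_univ x)

/-- A transversal for the cycles of a permutation all of whose cycles have length `p`. -/
lemma exists_transversal (hp : 0 < p) (hpow : σ ^ p = 1)
    (hσ : ∀ x, Function.minimalPeriod σ x = p) :
    ∃ T : Finset (Fin d), ∀ x, ∃! i : ℕ, i < p ∧ (σ ^ i) x ∈ T := by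
  classical
  let rep : Fin d → Fin d := fun x => (Quotient.mk (SameCycle.setoid σ) x).out
  have hrep (x : Fin d) : σ.SameCycle x (rep x) :=
    (Quotient.exact (Quotient.out_eq (Quotient.mk (SameCycle.setoid σ) x))).symm
  have rep_eq (x : Fin d) (i : ℕ) : rep ((σ ^ i) x) = rep x := by
    refine congrArg Quotient.out (Quotient.sound ?_)
    exact SameCycle.symm ⟨i, by simp⟩
  refine ⟨Finset.univ.filter fun x => x = rep x, fun x => ?_⟩
  simp only [Finset.mem_filter, Finset.mem_univ, true_and, rep_eq]
  obtain ⟨i, hi, hix⟩ := (hrep x).exists_pow_eq'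
  refine ⟨i, ⟨hi.trans_le (orderOf_le_of_pow_eq_one hp hpow), hix⟩, fun j hj => ?_⟩
  refine (Function.iterate_eq_iterate_iff_of_lt_minimalPeriod (f := σ) (x := x) ?_ ?_).1 ?_
  · rw [hσ]; exact hj.1
  · rw [hσ]; exact hi.trans_le (orderOf_le_of_pow_eq_one hp hpow)
  · rw [iterate_eq_pow, iterate_eq_pow, hix, hj.2]

lemma sum_range_indicator_pow_apply {R : Type*} [Semiring R] {T : Finset (Fin d)} {x : Fin d}
    (hT : ∃! i : ℕ, i < p ∧ (σ ^ i) x ∈ T) :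
    ∑ i ∈ Finset.range p, (if (σ ^ i) x ∈ T then 1 else 0 : R) = 1 := by
  obtain ⟨i, hi, huniq⟩ := hT
  rw [Finset.sum_eq_single i]
  · rw [if_pos hi.2]
  · intro j hj hji
    exact if_neg fun hjT => hji (huniq j ⟨Finset.mem_range.1 hj, hjT⟩)
  · intro hip
    exact absurd (Finset.mem_range.2 hi.1) hip

lemma card_transversal_mul {T : Finset (Fin d)}
    (hT : ∀ x, ∃! i : ℕ, i < p ∧ (σ ^ i) x ∈ T) : T.card * p = d := by
  have hsum : ∑ x : Fin d, ∑ i ∈ Finset.range p, (if (σ ^ i) x ∈ T then 1 else 0) = d := by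
    simp [sum_range_indicator_pow_apply (hT _)]
  rw [Finset.sum_comm] at hsum
  have hcard (i : ℕ) : ∑ x : Fin d, (if (σ ^ i) x ∈ T then 1 else 0) = T.card := by
    rw [Equiv.sum_comp (σ ^ i) fun y => if y ∈ T then 1 else 0]
    simp
  simp only [hcard, Finset.sum_const, Finset.card_range, smul_eq_mul] at hsum
  rw [mul_comm, hsum]

end Orbits

section PermutationModule

open Module

variable (K : Type*) [Field K] {d p : ℕ} (σ : Equiv.Perm (Fin d))

lemma permMap_pow_apply (i : ℕ) (v : Fin d → K) (x : Fin d) :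
    ((permMap K σ : End K (Fin d → K)) ^ i) v x = v ((σ ^ i) x) := by
  induction i generalizing v with
  | zero => rfl
  | succ i ih =>
    rw [pow_succ, Module.End.mul_apply, ih, pow_succ', Equiv.Perm.mul_apply]
    rfl

lemma sumFunctional_permMap (v : Fin d → K) :
    sumFunctional K d (permMap K σ v) = sumFunctional K d v :=
  Equiv.sum_comp σ v

lemma finrank_ker_permMap_sub_one_le {T : Finset (Fin d)}
    (hT : ∀ x, ∃ i : ℕ, (σ ^ i) x ∈ T) :
    finrank K (LinearMap.ker (permMap K σ - 1 : End K (Fin d → K))) ≤ T.card := by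
  let res : LinearMap.ker (permMap K σ - 1 : End K (Fin d → K)) →ₗ[K] (T → K) :=
    LinearMap.funLeft K K (Subtype.val : T → Fin d) ∘ₗ Submodule.subtype _
  have hres : Function.Injective res := by
    rw [← LinearMap.ker_eq_bot, LinearMap.ker_eq_bot']
    rintro ⟨v, hv⟩ hv0
    ext x
    obtain ⟨i, hi⟩ := hT x
    have hfix : permMap K σ v = v := sub_eq_zero.1 hv
    have hpow : ((permMap K σ : End K (Fin d → K)) ^ i) v = v := by
      rw [Module.End.pow_apply]
      exact Function.iterate_fixed hfix i
    have h0 := congrFun hv0 ⟨(σ ^ i) x, hi⟩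
    calc v x = v ((σ ^ i) x) := by rw [← permMap_pow_apply K σ i v x, hpow]
      _ = 0 := h0
  simpa using LinearMap.finrank_le_finrank_of_injective hres

lemma permEnd_sub_id_pow_mk (k : ℕ) (u : zeroSum K d) :
    ∃ w : zeroSum K d, (w : Fin d → K) = ((permMap K σ - 1 : End K (Fin d → K)) ^ k) u ∧
      ((permEnd K σ - LinearMap.id : End K (deletedPermModule K d)) ^ k) ((UW K d).mkQ u) = (UW K d).mkQ w := by
  induction k with
  | zero => exact ⟨u, rfl, rfl⟩
  | succ k ih =>
    obtain ⟨w, hw, hwk⟩ := ih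
    refine ⟨⟨permMap K σ w, permMap_mem_zeroSum K σ w.2⟩ - w, ?_, ?_⟩
    · rw [pow_succ', Module.End.mul_apply, ← hw]
      rfl
    · rw [pow_succ', Module.End.mul_apply, hwk]
      rfl

lemma finrank_ker_permEnd_sub_id_pow (hd : (d : K) = 0) (hd0 : d ≠ 0) (k : ℕ) :
    finrank K (LinearMap.ker ((permEnd K σ - LinearMap.id) ^ k)) + 1 =
      finrank K ((constSub K d).comap ((permMap K σ - 1 : End K (Fin d → K)) ^ k) ⊓
        zeroSum K d : Submodule K (Fin d → K)) := by
  have hone : (fun _ => 1 : Fin d → K) ∈ zeroSum K d := by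
    simp [zeroSum, sumFunctional, hd]
  have hle : constSub K d ≤ zeroSum K d := by
    rwa [constSub, Submodule.span_singleton_le_iff_mem]
  have hUW : finrank K (UW K d) = 1 := by
    rw [UW, inf_eq_right.2 hle, (Submodule.comapSubtypeEquivOfLe hle).finrank_eq]
    refine finrank_span_singleton fun h0 => one_ne_zero (congrFun h0 ⟨0, Nat.pos_of_ne_zero hd0⟩)
  have hcomap := Submodule.finrank_comap_eq (UW K d).mkQ
    (LinearMap.ker ((permEnd K σ - LinearMap.id) ^ k))
  rw [Submodule.range_mkQ, top_inf_eq, Submodule.ker_mkQ, hUW] at hcomap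
  rw [← hcomap, ← Submodule.finrank_map_subtype_eq, inf_comm, ← Submodule.map_comap_subtype]
  refine congrArg (fun S => finrank K (Submodule.map (zeroSum K d).subtype S)) ?_
  ext u
  obtain ⟨w, hw, hwk⟩ := permEnd_sub_id_pow_mk K σ k u
  rw [Submodule.mem_comap, LinearMap.mem_ker, hwk, Submodule.mkQ_apply,
    Submodule.Quotient.mk_eq_zero, UW, inf_eq_right.2 hle, Submodule.mem_comap,
    Submodule.mem_comap, Submodule.mem_comap, Submodule.subtype_apply, Submodule.subtype_apply, hw]

end PermutationModule

/-- Lemma 3.2(iii): if `char K = p`, `d = hp` with `h ≥ 1` and `p ∤ h`, and `σ ∈ S_d` has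
cycle type consisting of `h` cycles of length `p` (so `σ` is fixed-point-free), then the
induced endomorphism `g` of the fully deleted permutation module has Jordan form
`[J_p^{h-1}, J_{p-2}]`, i.e. `dim ker (g - 1)^k = (h-1)·min(k,p) + min(k,p-2)`. -/
theorem stmt_14 (p : ℕ) (hp : p.Prime) (K : Type*) [Field K] [CharP K p]
    (d h : ℕ) (hh : 1 ≤ h) (hd : d = h * p) (hph : ¬ p ∣ h)
    (σ : Equiv.Perm (Fin d)) (hσ : σ.cycleType = Multiset.replicate h p) (k : ℕ) :
    Module.finrank K (LinearMap.ker ((permEnd K σ - LinearMap.id) ^ k)) =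
      (h - 1) * min k p + min k (p - 2) := by
  have := Fact.mk hp
  have hpow := pow_eq_one_of_cycleType_eq_replicate hσ
  obtain ⟨T, hT⟩ := exists_transversal hp.pos hpow
    (minimalPeriod_of_cycleType_eq_replicate hp hd hσ)
  have hcard : T.card = h :=
    Nat.eq_of_mul_eq_mul_right hp.pos ((card_transversal_mul hT).trans hd)
  have hd0 : d ≠ 0 := hd ▸ Nat.mul_ne_zero (Nat.one_le_iff_ne_zero.1 hh) hp.ne_zero
  have : NeZero d := ⟨hd0⟩
  have : CharP (Module.End K (Fin d → K)) p :=
    charP_of_injective_algebraMap (algebraMap K (Module.End K (Fin d → K))).injective p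
  have hK : (d : K) = 0 := by simp [hd]
  apply Nat.add_right_cancel (m := 1)
  rw [finrank_ker_permEnd_sub_id_pow K σ hK hd0 k]
  refine Module.End.finrank_comap_span_inf_ker _ (sumFunctional K d)
    (t := fun x => if x ∈ T then 1 else 0) hp.two_le hh ?_ ?_ ?_ ?_ ?_ ?_ ?_ ?_ k
  · rw [sub_pow_char_of_commute p (Commute.one_right _), one_pow, sub_eq_zero]
    refine LinearMap.ext fun v => funext fun x => ?_
    rw [permMap_pow_apply, hpow]
    rfl
  · rw [Module.finrank_fin_fun, hd]
  · rw [← hcard]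
    exact finrank_ker_permMap_sub_one_le K σ fun x => (hT x).exists.imp fun _ hi => hi.2
  · refine LinearMap.ext fun v => ?_
    rw [LinearMap.comp_apply, LinearMap.sub_apply, map_sub, sumFunctional_permMap]
    exact sub_self _
  · exact fun h0 => one_ne_zero (congrFun h0 0)
  · exact sub_self _
  · rw [sub_one_pow_pred_eq_geom_sum]
    ext x
    simp only [LinearMap.sum_apply, Finset.sum_apply, permMap_pow_apply]
    exact sum_range_indicator_pow_apply (hT x)
  · simpa [sumFunctional, hcard] using (CharP.cast_eq_zero_iff K p h).not.2 hph
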